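/- For M ∈ {3, 9, 11}, the lattice D4 has no clean, geometrically similar sublattice of index M². -/

import Mathlib

/-- The lattice `D4 = {x ∈ ℤ⁴ : x 0 + x 1 + x 2 + x 3 is even}` inside
`EuclideanSpace ℝ (Fin 4)`. -/
noncomputable def D4 : AddSubgroup (EuclideanSpace ℝ (Fin 4)) where
  carrier := {x | ∃ v : Fin 4 → ℤ, (∀ i, x i = (v i : ℝ)) ∧ Even (v 0 + v 1 + v 2 + v 3)}
  zero_mem' := ⟨0, fun i => by simp, by simp⟩
  add_mem' := by
    rintro x y ⟨v, hv, kv, hkv⟩ ⟨w, hw, kw, hkw⟩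
    refine ⟨v + w, fun i => ?_, kv + kw, by simp only [Pi.add_apply]; omega⟩
    have : (x + y) i = x i + y i := rfl
    rw [this, hv i, hw i, Pi.add_apply]
    push_cast
    ring
  neg_mem' := by
    rintro x ⟨v, hv, kv, hkv⟩
    refine ⟨-v, fun i => ?_, -kv, by simp only [Pi.neg_apply]; omega⟩
    have : (-x) i = -(x i) := rfl
    rw [this, hv i, Pi.neg_apply]
    push_cast
    ring

/-- `Λ'` is clean in `Λ`: every point of `Λ` has a unique nearest point of `Λ'`
in the Euclidean norm. -/
def IsClean (Λ Λ' : AddSubgroup (EuclideanSpace ℝ (Fin 4))) : Prop :=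
  ∀ x ∈ Λ, ∃! p, p ∈ Λ' ∧ ∀ q ∈ Λ', ‖x - p‖ ≤ ‖x - q‖

/-- `Λ'` is a geometrically similar sublattice of `Λ` of index `N`:
`Λ' = {c·O(v) : v ∈ Λ}` for some `c > 0` and orthogonal matrix `O`, with
`[Λ : Λ'] = N`. -/
def IsSimilarSublattice (Λ Λ' : AddSubgroup (EuclideanSpace ℝ (Fin 4))) (N : ℕ) : Prop :=
  Λ' ≤ Λ ∧ (Λ'.addSubgroupOf Λ).index = N ∧
    ∃ (c : ℝ) (O : Matrix (Fin 4) (Fin 4) ℝ), 0 < c ∧ O * O.transpose = 1 ∧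
      Λ' = AddSubgroup.map (c • Matrix.toEuclideanLin O).toAddMonoidHom Λ

/-- `Λ'` is a geometrically strictly similar sublattice of `Λ` of index `N`:
as above, but additionally `det O = 1` (no reflections). -/
def IsStrictlySimilarSublattice (Λ Λ' : AddSubgroup (EuclideanSpace ℝ (Fin 4))) (N : ℕ) : Prop :=
  Λ' ≤ Λ ∧ (Λ'.addSubgroupOf Λ).index = N ∧
    ∃ (c : ℝ) (O : Matrix (Fin 4) (Fin 4) ℝ), 0 < c ∧ O * O.transpose = 1 ∧ O.det = 1 ∧
      Λ' = AddSubgroup.map (c • Matrix.toEuclideanLin O).toAddMonoidHom Λ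

/-- Integer dot product on `ℤ⁴`. -/
def dot4 (a b : ℤ × ℤ × ℤ × ℤ) : ℤ :=
  a.1 * b.1 + a.2.1 * b.2.1 + a.2.2.1 * b.2.2.1 + a.2.2.2 * b.2.2.2

/-- Doubled columns of a similarity preserving `D4`: they are orthogonal and half of their sum
is again in `D4`. -/
def Compatible (a b : ℤ × ℤ × ℤ × ℤ) : Prop :=
  dot4 a b = 0 ∧ (a.1 + b.1) % 2 = 0 ∧ (a.2.1 + b.2.1) % 2 = 0 ∧
    (a.2.2.1 + b.2.2.1) % 2 = 0 ∧ (a.2.2.2 + b.2.2.2) % 2 = 0 ∧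
      (dot4 a (1, 1, 1, 1) + dot4 b (1, 1, 1, 1)) % 4 = 0

instance (a b : ℤ × ℤ × ℤ × ℤ) : Decidable (Compatible a b) := by
  unfold Compatible; infer_instance

/-- The possible coordinates of an integer vector of squared norm less than `49`. -/
def smallInts : List ℤ := [-6, -5, -4, -3, -2, -1, 0, 1, 2, 3, 4, 5, 6]

/-- The integer vectors of squared norm `4 * M` with coordinates of equal parity, one from each
antipodal pair. -/
def halfShell (M : ℤ) : List (ℤ × ℤ × ℤ × ℤ) :=
  [0, 1, 2, 3, 4, 5, 6].flatMap fun p =>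
    (smallInts.filter fun q => (p + q) % 2 = 0 ∧ p * p + q * q ≤ 4 * M).flatMap fun q =>
      (smallInts.filter fun r => (p + r) % 2 = 0 ∧ p * p + q * q + r * r ≤ 4 * M).flatMap fun r =>
        (smallInts.filter fun s => p * p + q * q + r * r + s * s = 4 * M ∧
          0 ≤ 2197 * p + 169 * q + 13 * r + s).map fun s => (p, q, r, s)

/-- The vector `z` lies on the boundary of the Voronoi cell of `D4` scaled by `2 * M`. -/
def OnVoronoiBoundary (M : ℤ) (z : ℤ × ℤ × ℤ × ℤ) : Prop :=
  (|z.1| + |z.2.1| ≤ 2 * M ∧ |z.1| + |z.2.2.1| ≤ 2 * M ∧ |z.1| + |z.2.2.2| ≤ 2 * M ∧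
    |z.2.1| + |z.2.2.1| ≤ 2 * M ∧ |z.2.1| + |z.2.2.2| ≤ 2 * M ∧
      |z.2.2.1| + |z.2.2.2| ≤ 2 * M) ∧
  (|z.1| + |z.2.1| = 2 * M ∨ |z.1| + |z.2.2.1| = 2 * M ∨ |z.1| + |z.2.2.2| = 2 * M ∨
    |z.2.1| + |z.2.2.1| = 2 * M ∨ |z.2.1| + |z.2.2.2| = 2 * M ∨
      |z.2.2.1| + |z.2.2.2| = 2 * M)

instance (M : ℤ) (z : ℤ × ℤ × ℤ × ℤ) : Decidable (OnVoronoiBoundary M z) := by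
  unfold OnVoronoiBoundary; infer_instance

/-- Points of `D4` among which a tie can always be found. -/
def witnesses : List (ℤ × ℤ × ℤ × ℤ) := [(1, 1, 0, 0), (2, 1, 1, 0), (2, -1, 1, 0), (1, 2, 1, 0)]

/-- Every orthogonal frame taken from `l` has a tie. -/
def AllTied (M : ℤ) (l : List (ℤ × ℤ × ℤ × ℤ)) : Prop :=
  ∀ a ∈ l, ∀ b ∈ l.filter (Compatible a), ∀ c ∈ (l.filter (Compatible a)).filter (Compatible b),
    ∀ d ∈ ((l.filter (Compatible a)).filter (Compatible b)).filter (Compatible c),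
      ∃ x ∈ witnesses, OnVoronoiBoundary M (dot4 a x, dot4 b x, dot4 c x, dot4 d x)

/-- `k (l.filter p)`, arranged so that the kernel evaluates the filtered list only once. -/
def filterThen {α : Type*} (p : α → Bool) : List α → (List α → Bool) → Bool
  | [], k => k []
  | x :: l, k => bif p x then filterThen p l (fun r => k (x :: r)) else filterThen p l k

theorem filterThen_eq {α : Type*} (p : α → Bool) (l : List α) (k : List α → Bool) :
    filterThen p l k = k (l.filter p) := by
  induction l generalizing k with
  | nil => rfl
  | cons x l ih => cases h : p x <;> simp [filterThen, ih, h]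

/-- A boolean test for `AllTied`. -/
def tieCheck (M : ℤ) (l : List (ℤ × ℤ × ℤ × ℤ)) : Bool :=
  l.all fun a => filterThen (fun b => decide (Compatible a b)) l fun la =>
    la.all fun b => filterThen (fun c => decide (Compatible b c)) la fun lb =>
      lb.all fun c => filterThen (fun d => decide (Compatible c d)) lb fun lc =>
        lc.all fun d => witnesses.any fun x =>
          decide (OnVoronoiBoundary M (dot4 a x, dot4 b x, dot4 c x, dot4 d x))

theorem AllTied.of_check {M : ℤ} {l : List (ℤ × ℤ × ℤ × ℤ)}
    (h : filterThen (fun _ => true) l (tieCheck M) = true) : AllTied M l := by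
  simp only [filterThen_eq, List.filter_true, tieCheck, List.all_eq_true, List.any_eq_true,
    decide_eq_true_eq] at h
  exact h

theorem allTied_three : AllTied 3 (halfShell 3) := .of_check (by decide +kernel)

theorem allTied_nine : AllTied 9 (halfShell 9) := .of_check (by decide +kernel)

theorem allTied_eleven : AllTied 11 (halfShell 11) := .of_check (by decide +kernel)

theorem exists_sign_mul_eq_abs (p : ℤ) : ∃ ε : ℤ, (ε = 1 ∨ ε = -1) ∧ p * ε = |p| := by
  rcases abs_cases p with ⟨h, -⟩ | ⟨h, -⟩
  · exact ⟨1, .inl rfl, by rw [h, mul_one]⟩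
  · exact ⟨-1, .inr rfl, by rw [h]; ring⟩

theorem mul_le_mul_sq {M p w : ℤ} (hp : |p| ≤ M) : p * w ≤ M * (w * w) := by
  have h1 : p * w ≤ |p| * |w| := by rw [← abs_mul]; exact le_abs_self _
  have h2 : |w| ≤ w * w := by
    rw [← abs_mul_abs_self w]
    rcases (abs_nonneg w).lt_or_eq with h | h
    · nlinarith
    · simp [← h]
  nlinarith [abs_nonneg p, abs_nonneg w, mul_le_mul_of_nonneg_right hp (abs_nonneg w),
    mul_le_mul_of_nonneg_left h2 ((abs_nonneg p).trans hp)]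

/-- The scaled Voronoi inequality when the first coordinate dominates. -/
theorem voronoi_ineq_of_lt {M p q r s a b c d : ℤ} (hp : M < |p|) (hq : |p| + |q| ≤ 2 * M)
    (hr : |p| + |r| ≤ 2 * M) (hs : |p| + |s| ≤ 2 * M) (he : Even (a + b + c + d)) :
    p * a + q * b + r * c + s * d ≤ M * (a * a + b * b + c * c + d * d) := by
  have key : ∀ x y : ℤ, x * y ≤ |x| * |y| := fun x y => by
    rw [← abs_mul]; exact le_abs_self _
  have sq : ∀ x : ℤ, |x| ≤ |x| * |x| := fun x => by
    rcases (abs_nonneg x).lt_or_eq with h | h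
    · nlinarith
    · simp [← h]
  have he' : Even (|a| + |b| + |c| + |d|) := by
    simpa [Int.even_add, even_abs] using he
  rw [← abs_mul_abs_self a, ← abs_mul_abs_self b, ← abs_mul_abs_self c, ← abs_mul_abs_self d]
  have h1 := key p a
  have h2 := key q b
  have h3 := key r c
  have h4 := key s d
  have s1 := sq a
  have s2 := sq b
  have s3 := sq c
  have s4 := sq d
  have a0 := abs_nonneg a
  have b0 := abs_nonneg b
  have c0 := abs_nonneg c
  have d0 := abs_nonneg d
  have q0 := abs_nonneg q
  generalize |a| = a' at *
  generalize |b| = b' at *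
  generalize |c| = c' at *
  generalize |d| = d' at *
  generalize |p| = p' at *
  generalize |q| = q' at *
  generalize |r| = r' at *
  generalize |s| = s' at *
  have e2 : q' * b' ≤ (2 * M - p') * b' := mul_le_mul_of_nonneg_right (by linarith) b0
  have e3 : r' * c' ≤ (2 * M - p') * c' := mul_le_mul_of_nonneg_right (by linarith) c0
  have e4 : s' * d' ≤ (2 * M - p') * d' := mul_le_mul_of_nonneg_right (by linarith) d0
  have M0 : 0 ≤ M := by linarith
  have f1 := mul_le_mul_of_nonneg_left s1 M0
  have f2 := mul_le_mul_of_nonneg_left s2 M0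
  have f3 := mul_le_mul_of_nonneg_left s3 M0
  have f4 := mul_le_mul_of_nonneg_left s4 M0
  by_cases h : a' ≤ b' + c' + d'
  · nlinarith [mul_nonneg (sub_nonneg.2 hp.le) (sub_nonneg.2 h)]
  · have ha : 2 ≤ a' := by
      obtain ⟨k, hk⟩ := he'
      omega
    have g1 := mul_le_mul_of_nonneg_left (mul_le_mul_of_nonneg_right ha a0) M0
    nlinarith [mul_nonneg (by linarith : 0 ≤ 2 * M - p') (by linarith : 0 ≤ a' - (b' + c' + d'))]

theorem OnVoronoiBoundary.dot4_le {M : ℤ} {z : ℤ × ℤ × ℤ × ℤ} (h : OnVoronoiBoundary M z)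
    (w : ℤ × ℤ × ℤ × ℤ) (hw : Even (w.1 + w.2.1 + w.2.2.1 + w.2.2.2)) :
    dot4 z w ≤ M * dot4 w w := by
  obtain ⟨p, q, r, s⟩ := z
  obtain ⟨a, b, c, d⟩ := w
  obtain ⟨⟨h1, h2, h3, h4, h5, h6⟩, -⟩ := h
  simp only [dot4] at *
  by_cases hp : M < |p|
  · exact voronoi_ineq_of_lt hp h1 h2 h3 hw
  by_cases hq : M < |q|
  · linarith [voronoi_ineq_of_lt (a := b) (b := a) (c := c) (d := d) (q := p) (r := r) (s := s)
      hq (by linarith) h4 h5 (by convert hw using 1; ring)]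
  by_cases hr : M < |r|
  · linarith [voronoi_ineq_of_lt (a := c) (b := a) (c := b) (d := d) (q := p) (r := q) (s := s)
      hr (by linarith) (by linarith) h6 (by convert hw using 1; ring)]
  by_cases hs : M < |s|
  · linarith [voronoi_ineq_of_lt (a := d) (b := a) (c := b) (d := c) (q := p) (r := q) (s := r)
      hs (by linarith) (by linarith) (by linarith) (by convert hw using 1; ring)]
  · linarith [mul_le_mul_sq (w := a) (not_lt.1 hp), mul_le_mul_sq (w := b) (not_lt.1 hq),
      mul_le_mul_sq (w := c) (not_lt.1 hr), mul_le_mul_sq (w := d) (not_lt.1 hs)]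

theorem OnVoronoiBoundary.exists_dot4_eq {M : ℤ} {z : ℤ × ℤ × ℤ × ℤ}
    (h : OnVoronoiBoundary M z) :
    ∃ w : ℤ × ℤ × ℤ × ℤ, w ≠ 0 ∧ Even (w.1 + w.2.1 + w.2.2.1 + w.2.2.2) ∧
      dot4 z w = M * dot4 w w := by
  obtain ⟨p, q, r, s⟩ := z
  obtain ⟨-, h⟩ := h
  simp only [dot4] at *
  obtain ⟨ε₁, e1, h1⟩ := exists_sign_mul_eq_abs p
  obtain ⟨ε₂, e2, h2⟩ := exists_sign_mul_eq_abs q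
  obtain ⟨ε₃, e3, h3⟩ := exists_sign_mul_eq_abs r
  obtain ⟨ε₄, e4, h4⟩ := exists_sign_mul_eq_abs s
  have sq : ∀ ε : ℤ, (ε = 1 ∨ ε = -1) → ε * ε = 1 ∧ ε ≠ 0 := by
    rintro ε (rfl | rfl) <;> simp
  have ev : ∀ ε δ : ℤ, (ε = 1 ∨ ε = -1) → (δ = 1 ∨ δ = -1) → Even (ε + δ) := by
    rintro ε δ (rfl | rfl) (rfl | rfl) <;> decide
  rcases h with h | h | h | h | h | h
  · exact ⟨(ε₁, ε₂, 0, 0), by simp [sq ε₁ e1], by simpa using ev _ _ e1 e2,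
      by simp [h1, h2, h, sq ε₁ e1, sq ε₂ e2, mul_comm]⟩
  · exact ⟨(ε₁, 0, ε₃, 0), by simp [sq ε₁ e1], by simpa using ev _ _ e1 e3,
      by simp [h1, h3, h, sq ε₁ e1, sq ε₃ e3, mul_comm]⟩
  · exact ⟨(ε₁, 0, 0, ε₄), by simp [sq ε₁ e1], by simpa using ev _ _ e1 e4,
      by simp [h1, h4, h, sq ε₁ e1, sq ε₄ e4, mul_comm]⟩
  · exact ⟨(0, ε₂, ε₃, 0), by simp [sq ε₂ e2], by simpa using ev _ _ e2 e3,
      by simp [h2, h3, h, sq ε₂ e2, sq ε₃ e3, mul_comm]⟩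
  · exact ⟨(0, ε₂, 0, ε₄), by simp [sq ε₂ e2], by simpa using ev _ _ e2 e4,
      by simp [h2, h4, h, sq ε₂ e2, sq ε₄ e4, mul_comm]⟩
  · exact ⟨(0, 0, ε₃, ε₄), by simp [sq ε₃ e3], by simpa using ev _ _ e3 e4,
      by simp [h3, h4, h, sq ε₃ e3, sq ε₄ e4, mul_comm]⟩

theorem exists_mem_halfShell {M : ℤ} (hM : M ≤ 12) (v : ℤ × ℤ × ℤ × ℤ)
    (hv : dot4 v v = 4 * M) (he : Even (dot4 v (1, 1, 1, 1))) :
    ∃ v' ∈ halfShell M, v' = v ∨ v' = -v := by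
  have main : ∀ p q r s : ℤ, p * p + q * q + r * r + s * s = 4 * M → Even (p + q + r + s) →
      0 ≤ 2197 * p + 169 * q + 13 * r + s → (p, q, r, s) ∈ halfShell M := by
    intro p q r s h he h0
    have bd : ∀ x : ℤ, x * x ≤ 4 * M → -6 ≤ x ∧ x ≤ 6 := fun x hx => by
      constructor <;> nlinarith
    have p2 := mul_self_nonneg p
    have q2 := mul_self_nonneg q
    have r2 := mul_self_nonneg r
    have s2 := mul_self_nonneg s
    have mem : ∀ x : ℤ, x * x ≤ 4 * M → x ∈ smallInts := fun x hx => by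
      obtain ⟨h1, h2⟩ := bd x hx
      interval_cases x <;> simp [smallInts]
    have par : (p + q) % 2 = 0 ∧ (p + r) % 2 = 0 := by
      rcases Int.even_or_odd' p with ⟨a, rfl | rfl⟩ <;>
      rcases Int.even_or_odd' q with ⟨b, rfl | rfl⟩ <;>
      rcases Int.even_or_odd' r with ⟨c, rfl | rfl⟩ <;>
      rcases Int.even_or_odd' s with ⟨d, rfl | rfl⟩ <;>
      obtain ⟨k, hk⟩ := he <;> ring_nf at h <;> omega
    obtain ⟨p1, p3⟩ := bd p (by linarith)
    obtain ⟨q1, q3⟩ := bd q (by linarith)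
    obtain ⟨r1, r3⟩ := bd r (by linarith)
    obtain ⟨s1, s3⟩ := bd s (by linarith)
    have hp : p ∈ [0, 1, 2, 3, 4, 5, 6] := by
      have : 0 ≤ p := by omega
      interval_cases p <;> simp
    unfold halfShell
    simp only [List.mem_flatMap, List.mem_map, List.mem_filter, decide_eq_true_eq]
    exact ⟨p, hp, q, ⟨mem q (by linarith), par.1, by linarith⟩, r,
      ⟨mem r (by linarith), par.2, by linarith⟩, s, ⟨mem s (by linarith), h, h0⟩, rfl⟩
  obtain ⟨p, q, r, s⟩ := v
  simp only [dot4, mul_one] at hv he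
  rcases le_total 0 (2197 * p + 169 * q + 13 * r + s) with h | h
  · exact ⟨_, main p q r s hv he h, .inl rfl⟩
  · refine ⟨_, main (-p) (-q) (-r) (-s) (by linarith) ?_ (by linarith), .inr rfl⟩
    simpa [Int.even_add] using he

theorem Compatible.congr_neg {a b a' b' : ℤ × ℤ × ℤ × ℤ} (h : Compatible a b)
    (ha : Even (dot4 a (1, 1, 1, 1))) (hb : Even (dot4 b (1, 1, 1, 1)))
    (ha' : a' = a ∨ a' = -a) (hb' : b' = b ∨ b' = -b) : Compatible a' b' := by
  obtain ⟨a1, a2, a3, a4⟩ := a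
  obtain ⟨b1, b2, b3, b4⟩ := b
  obtain ⟨h0, h1, h2, h3, h4, h5⟩ := h
  obtain ⟨k, hk⟩ := ha
  obtain ⟨l, hl⟩ := hb
  simp only [dot4, mul_one] at *
  rcases ha' with rfl | rfl <;> rcases hb' with rfl | rfl <;>
    refine ⟨?_, ?_, ?_, ?_, ?_, ?_⟩ <;>
    simp only [dot4, mul_one, Prod.neg_mk] <;>
    first | linarith | omega

theorem abs_dot4_congr_neg {a a' : ℤ × ℤ × ℤ × ℤ} (h : a' = a ∨ a' = -a) (x : ℤ × ℤ × ℤ × ℤ) :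
    |dot4 a' x| = |dot4 a x| := by
  rcases h with rfl | rfl
  · rfl
  · rw [← abs_neg]
    congr 1
    simp only [dot4, Prod.fst_neg, Prod.snd_neg]
    ring

/-- Every integral frame coming from a similarity of norm `3`, `9` or `11` has a tie. -/
theorem exists_onVoronoiBoundary {M : ℤ} (hM : M = 3 ∨ M = 9 ∨ M = 11)
    (b : Fin 4 → ℤ × ℤ × ℤ × ℤ) (hn : ∀ i, dot4 (b i) (b i) = 4 * M)
    (he : ∀ i, Even (dot4 (b i) (1, 1, 1, 1))) (hc : ∀ i j, i ≠ j → Compatible (b i) (b j)) :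
    ∃ x ∈ witnesses,
      OnVoronoiBoundary M (dot4 (b 0) x, dot4 (b 1) x, dot4 (b 2) x, dot4 (b 3) x) := by
  have tied : AllTied M (halfShell M) := by
    rcases hM with rfl | rfl | rfl
    exacts [allTied_three, allTied_nine, allTied_eleven]
  have hM' : M ≤ 12 := by omega
  choose b' hb' hs using fun i => exists_mem_halfShell hM' (b i) (hn i) (he i)
  have hc' : ∀ i j, i ≠ j → Compatible (b' i) (b' j) := fun i j hij =>
    (hc i j hij).congr_neg (he i) (he j) (hs i) (hs j)
  obtain ⟨x, hx, h⟩ := tied (b' 0) (hb' 0) (b' 1) (by simp [hb', hc']) (b' 2) (by simp [hb', hc'])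
    (b' 3) (by simp [hb', hc'])
  refine ⟨x, hx, ?_⟩
  simpa only [OnVoronoiBoundary, abs_dot4_congr_neg (hs _)] using h

/-- The index of the range of an injective endomorphism of `ℤⁿ` is its determinant. -/
theorem index_range_eq_natAbs_det {n : ℕ} (Q : Matrix (Fin n) (Fin n) ℤ)
    (hQ : Function.Injective Q.mulVecLin) :
    (LinearMap.range Q.mulVecLin).toAddSubgroup.index = Q.det.natAbs := by
  have h := Submodule.natAbs_det_equiv (LinearMap.range Q.mulVecLin)
    (LinearEquiv.ofInjective Q.mulVecLin hQ)
  have h2 : (LinearMap.range Q.mulVecLin).subtype ∘ₗ AddMonoidHom.toIntLinearMap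
      ((LinearEquiv.ofInjective Q.mulVecLin hQ : (Fin n → ℤ) ≃ₗ[ℤ] _) :
        (Fin n → ℤ) →+ LinearMap.range Q.mulVecLin) = Matrix.toLin' Q := by
    ext
    rfl
  rw [h2, LinearMap.det_toLin'] at h
  exact h.symm

/-- The columns of this matrix are a basis of `D4`. -/
def D4basis : Matrix (Fin 4) (Fin 4) ℤ := !![1, 1, 0, 0; 1, -1, 1, 0; 0, 0, -1, 1; 0, 0, 0, -1]

/-- Coordinates of the points of `D4`. -/
noncomputable def D4coord : (Fin 4 → ℤ) →+ EuclideanSpace ℝ (Fin 4) where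
  toFun v := WithLp.toLp 2 fun i => ((D4basis.mulVec v i : ℤ) : ℝ)
  map_zero' := by ext; simp
  map_add' v w := by ext; simp [Matrix.mulVec_add]

theorem D4coord_apply (v : Fin 4 → ℤ) (i : Fin 4) :
    D4coord v i = ((D4basis.mulVec v i : ℤ) : ℝ) := rfl

theorem D4coord_injective : Function.Injective D4coord := by
  rw [injective_iff_map_eq_zero]
  intro v hv
  have h : ∀ i, D4basis.mulVec v i = 0 := fun i => by
    have := congrArg (fun x : EuclideanSpace ℝ (Fin 4) => x i) hv
    simpa [D4coord_apply] using this
  have h0 := h 0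
  have h1 := h 1
  have h2 := h 2
  have h3 := h 3
  simp [D4basis, Matrix.mulVec, dotProduct, Fin.sum_univ_four] at h0 h1 h2 h3
  ext i
  fin_cases i <;> simp <;> omega

theorem D4coord_range : D4coord.range = D4 := by
  ext x
  constructor
  · rintro ⟨v, rfl⟩
    refine ⟨D4basis.mulVec v, fun i => rfl, v 0, ?_⟩
    simp [D4basis, Matrix.mulVec, dotProduct, Fin.sum_univ_four]
    ring
  · rintro ⟨u, hu, k, hk⟩
    refine ⟨![k, k - u 1 - u 2 - u 3, -u 2 - u 3, -u 3], ?_⟩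
    ext i
    rw [D4coord_apply, hu i]
    congr 1
    fin_cases i <;> simp [D4basis, Matrix.mulVec, dotProduct, Fin.sum_univ_four] <;> omega

/-- The index of a sublattice of `D4` that is the image of `D4` under a matrix. -/
theorem relIndex_map_D4 (S : Matrix (Fin 4) (Fin 4) ℝ) (hS : S.det ≠ 0)
    (hle : AddSubgroup.map (Matrix.toEuclideanLin S).toAddMonoidHom D4 ≤ D4) :
    ((AddSubgroup.map (Matrix.toEuclideanLin S).toAddMonoidHom D4).relIndex D4 : ℝ) = |S.det| := by
  have hex : ∀ j : Fin 4, ∃ q : Fin 4 → ℤ,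
      D4coord q = Matrix.toEuclideanLin S (D4coord (Pi.single j 1)) := fun j => by
    have : Matrix.toEuclideanLin S (D4coord (Pi.single j 1)) ∈ D4 :=
      hle ⟨_, D4coord_range ▸ ⟨_, rfl⟩, rfl⟩
    rw [← D4coord_range] at this
    exact this
  choose q hq using hex
  set Q : Matrix (Fin 4) (Fin 4) ℤ := Matrix.of fun i j => q j i with hQ
  have hcomm : D4basis.map (Int.cast : ℤ → ℝ) * Q.map (Int.cast : ℤ → ℝ) =
      S * D4basis.map (Int.cast : ℤ → ℝ) := by
    ext i j
    have := congrArg (fun x : EuclideanSpace ℝ (Fin 4) => x i) (hq j)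
    simpa [D4coord_apply, Matrix.mul_apply, Matrix.toLpLin_apply, Matrix.mulVec,
      dotProduct, Pi.single_apply, hQ] using this
  have hB : (D4basis.map (Int.cast : ℤ → ℝ)).det ≠ 0 := by
    have h1 : D4basis.det ≠ 0 := by decide
    have h2 := Int.cast_det (R := ℝ) D4basis
    rw [← h2]
    exact_mod_cast h1
  have hdet : (Q.det : ℝ) = S.det := by
    have := congrArg Matrix.det hcomm
    rw [Matrix.det_mul, Matrix.det_mul, mul_comm] at this
    rw [Int.cast_det]
    exact mul_right_cancel₀ hB this
  have hQ0 : Q.det ≠ 0 := by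
    intro h
    rw [h] at hdet
    exact hS (by simpa using hdet.symm)
  have hinj : Function.Injective Q.mulVecLin := by
    rw [← LinearMap.ker_eq_bot, LinearMap.ker_eq_bot']
    intro m hm
    exact Matrix.eq_zero_of_mulVec_eq_zero hQ0 hm
  have hcomp : (Matrix.toEuclideanLin S).toAddMonoidHom.comp D4coord =
      D4coord.comp Q.mulVecLin.toAddMonoidHom := by
    ext v i
    have h1 : (D4basis.mulVec (Q.mulVec (Pi.single v 1)) i : ℝ) =
        (D4basis.map (Int.cast : ℤ → ℝ) * Q.map (Int.cast : ℤ → ℝ)) i v := by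
      simp [Matrix.mul_apply, Matrix.mulVec, dotProduct, Pi.single_apply]
    have h2 := congrFun₂ hcomm i v
    rw [← h1] at h2
    simpa [D4coord_apply, Matrix.mul_apply, Matrix.toLpLin_apply, Matrix.mulVec,
      dotProduct, Pi.single_apply] using h2.symm
  have hmap : AddSubgroup.map (Matrix.toEuclideanLin S).toAddMonoidHom D4 =
      AddSubgroup.map D4coord (LinearMap.range Q.mulVecLin).toAddSubgroup := by
    rw [← D4coord_range, AddMonoidHom.map_range, hcomp, ← AddMonoidHom.map_range]
    rfl
  have htop : D4 = AddSubgroup.map D4coord ⊤ := by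
    rw [← AddMonoidHom.range_eq_map, D4coord_range]
  rw [hmap]
  rw [htop]
  rw [AddSubgroup.relIndex_map_map_of_injective _ _ D4coord_injective,
    AddSubgroup.relIndex_top_right, index_range_eq_natAbs_det Q hinj, ← hdet,
    Nat.cast_natAbs, Int.cast_abs]

/-- A similar sublattice of index `M ^ 2` is the image of `D4` under a matrix of norm `M`. -/
theorem IsSimilarSublattice.exists_matrix {Λ' : AddSubgroup (EuclideanSpace ℝ (Fin 4))} {M : ℕ}
    (h : IsSimilarSublattice D4 Λ' (M ^ 2)) :
    ∃ S : Matrix (Fin 4) (Fin 4) ℝ, S.transpose * S = (M : ℝ) • 1 ∧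
      Λ' = AddSubgroup.map (Matrix.toEuclideanLin S).toAddMonoidHom D4 := by
  obtain ⟨hle, hidx, c, O, hc, hO, rfl⟩ := h
  refine ⟨c • O, ?_, by rw [map_smul]⟩
  have hdO : |O.det| = 1 := by
    have := congrArg Matrix.det hO
    rw [Matrix.det_mul, Matrix.det_transpose, Matrix.det_one] at this
    rcases mul_self_eq_one_iff.1 this with h | h <;> simp [h]
  have hdet : |(c • O).det| = c ^ 4 := by
    rw [Matrix.det_smul, abs_mul, hdO, mul_one, Fintype.card_fin, abs_of_pos (by positivity)]
  rw [← map_smul] at hle hidx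
  have hi := relIndex_map_D4 (c • O) (by rw [← abs_pos, hdet]; positivity) hle
  rw [AddSubgroup.relIndex, hidx, hdet] at hi
  have hcM : c ^ 2 = M := by
    push_cast at hi
    have : (c ^ 2) ^ 2 = (M : ℝ) ^ 2 := by rw [hi]; ring
    exact (pow_left_inj₀ (by positivity) (by positivity) two_ne_zero).1 this
  rw [Matrix.transpose_smul, Matrix.smul_mul, Matrix.mul_smul, smul_smul,
    mul_eq_one_comm.1 hO, ← hcM, sq]

theorem norm_sub_toEuclideanLin_sq {S : Matrix (Fin 4) (Fin 4) ℝ} {m : ℝ}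
    (hS : S.transpose * S = m • 1) (x w : EuclideanSpace ℝ (Fin 4)) :
    ‖x - Matrix.toEuclideanLin S w‖ ^ 2 =
      ‖x‖ ^ 2 + (m * ∑ i, w i * w i - 2 * ∑ i, (∑ k, S k i * x k) * w i) := by
  have H : ∀ i j, ∑ k, S k i * S k j = if i = j then m else 0 := fun i j => by
    have := congrFun₂ hS i j
    simpa [Matrix.mul_apply, Matrix.one_apply] using this
  have h00 := H 0 0
  have h01 := H 0 1
  have h02 := H 0 2
  have h03 := H 0 3
  have h11 := H 1 1
  have h12 := H 1 2
  have h13 := H 1 3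
  have h22 := H 2 2
  have h23 := H 2 3
  have h33 := H 3 3
  simp [Fin.sum_univ_four] at h00 h01 h02 h03 h11 h12 h13 h22 h23 h33
  rw [EuclideanSpace.real_norm_sq_eq, EuclideanSpace.real_norm_sq_eq]
  simp only [Matrix.toLpLin_apply, PiLp.sub_apply, Matrix.mulVec, dotProduct,
    Fin.sum_univ_four]
  linear_combination w 0 * w 0 * h00 + w 1 * w 1 * h11 + w 2 * w 2 * h22 + w 3 * w 3 * h33 +
    2 * w 0 * w 1 * h01 + 2 * w 0 * w 2 * h02 + 2 * w 0 * w 3 * h03 + 2 * w 1 * w 2 * h12 +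
    2 * w 1 * w 3 * h13 + 2 * w 2 * w 3 * h23

/-- A point of `D4` equidistant from `0` and another nearest point obstructs cleanness. -/
theorem not_isClean_of_tie {S : Matrix (Fin 4) (Fin 4) ℝ} {m : ℝ} (hm : 0 < m)
    (hS : S.transpose * S = m • 1) {x v : EuclideanSpace ℝ (Fin 4)} (hx : x ∈ D4) (hv : v ∈ D4)
    (hv0 : v ≠ 0)
    (hle : ∀ w ∈ D4, 2 * ∑ i, (∑ k, S k i * x k) * w i ≤ m * ∑ i, w i * w i)
    (heq : 2 * ∑ i, (∑ k, S k i * x k) * v i = m * ∑ i, v i * v i) :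
    ¬ IsClean D4 (AddSubgroup.map (Matrix.toEuclideanLin S).toAddMonoidHom D4) := by
  intro hclean
  obtain ⟨p, -, hp⟩ := hclean x hx
  have hfar : ∀ w ∈ D4, ‖x‖ ≤ ‖x - Matrix.toEuclideanLin S w‖ := fun w hw => by
    refine (pow_le_pow_iff_left₀ (norm_nonneg _) (norm_nonneg _) two_ne_zero).1 ?_
    rw [norm_sub_toEuclideanLin_sq hS]
    linarith [hle w hw]
  have hv' : ‖x - Matrix.toEuclideanLin S v‖ = ‖x‖ := by
    refine (pow_left_inj₀ (norm_nonneg _) (norm_nonneg _) two_ne_zero).1 ?_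
    rw [norm_sub_toEuclideanLin_sq hS]
    linarith
  have h0 : (0 : EuclideanSpace ℝ (Fin 4)) = p := by
    refine hp 0 ⟨zero_mem _, ?_⟩
    rintro _ ⟨w, hw, rfl⟩
    rw [sub_zero]
    exact hfar w hw
  have h1 : Matrix.toEuclideanLin S v = p := by
    refine hp _ ⟨⟨v, hv, rfl⟩, ?_⟩
    rintro _ ⟨w, hw, rfl⟩
    rw [hv']
    exact hfar w hw
  apply hv0
  have h2 := norm_sub_toEuclideanLin_sq hS 0 v
  rw [h1, ← h0] at h2
  simp [hm.ne'] at h2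
  ext i
  have h3 : ∀ i ∈ Finset.univ, v i * v i = 0 :=
    (Finset.sum_eq_zero_iff_of_nonneg fun i _ => mul_self_nonneg _).1 h2
  simpa using h3 i (Finset.mem_univ i)

/-- The point of `ℝ⁴` with given integer coordinates. -/
noncomputable def intPoint (w : ℤ × ℤ × ℤ × ℤ) : EuclideanSpace ℝ (Fin 4) :=
  !₂[(w.1 : ℝ), (w.2.1 : ℝ), (w.2.2.1 : ℝ), (w.2.2.2 : ℝ)]

theorem mem_D4_iff_intPoint {x : EuclideanSpace ℝ (Fin 4)} :
    x ∈ D4 ↔ ∃ w : ℤ × ℤ × ℤ × ℤ, Even (w.1 + w.2.1 + w.2.2.1 + w.2.2.2) ∧ intPoint w = x := by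
  constructor
  · rintro ⟨v, hv, he⟩
    refine ⟨(v 0, v 1, v 2, v 3), he, ?_⟩
    ext i
    fin_cases i <;> simp [intPoint, hv]
  · rintro ⟨w, he, rfl⟩
    refine ⟨![w.1, w.2.1, w.2.2.1, w.2.2.2], fun i => ?_, by simpa using he⟩
    fin_cases i <;> simp [intPoint]

theorem intPoint_ne_zero {w : ℤ × ℤ × ℤ × ℤ} (hw : w ≠ 0) : intPoint w ≠ 0 := by
  intro h
  apply hw
  have h' : ∀ i, intPoint w i = 0 := fun i => by rw [h]; rfl
  have h0 := h' 0
  have h1 := h' 1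
  have h2 := h' 2
  have h3 := h' 3
  simp [intPoint] at h0 h1 h2 h3
  ext <;> simpa

/-- The doubled columns of a norm `M` similarity preserving `D4` form an integral frame. -/
theorem exists_integral_frame {S : Matrix (Fin 4) (Fin 4) ℝ} {M : ℕ}
    (hS : S.transpose * S = (M : ℝ) • 1)
    (hle : AddSubgroup.map (Matrix.toEuclideanLin S).toAddMonoidHom D4 ≤ D4) :
    ∃ b : Fin 4 → ℤ × ℤ × ℤ × ℤ,
      (∀ i, ((b i).1 : ℝ) = 2 * S 0 i ∧ ((b i).2.1 : ℝ) = 2 * S 1 i ∧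
        ((b i).2.2.1 : ℝ) = 2 * S 2 i ∧ ((b i).2.2.2 : ℝ) = 2 * S 3 i) ∧
      (∀ i, dot4 (b i) (b i) = 4 * M) ∧ (∀ i, Even (dot4 (b i) (1, 1, 1, 1))) ∧
      ∀ i j, i ≠ j → Compatible (b i) (b j) := by
  have H : ∀ i j, ∑ k, S k i * S k j = if i = j then (M : ℝ) else 0 := fun i j => by
    have := congrFun₂ hS i j
    simpa [Matrix.mul_apply, Matrix.one_apply] using this
  have hint : ∀ u : Fin 4 → ℤ, Even (u 0 + u 1 + u 2 + u 3) →
      ∃ t : Fin 4 → ℤ, (∀ k, ∑ i, S k i * (u i : ℝ) = t k) ∧ Even (t 0 + t 1 + t 2 + t 3) := by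
    intro u hu
    obtain ⟨t, ht, he⟩ := hle ⟨WithLp.toLp 2 fun i => (u i : ℝ), ⟨u, fun i => rfl, hu⟩, rfl⟩
    exact ⟨t, fun k => ht k, he⟩
  have hsum : ∀ i : Fin 4, ∀ n : ℤ, (Pi.single i n : Fin 4 → ℤ) 0 + (Pi.single i n : Fin 4 → ℤ) 1 +
      (Pi.single i n : Fin 4 → ℤ) 2 + (Pi.single i n : Fin 4 → ℤ) 3 = n := fun i n => by
    fin_cases i <;> simp
  choose t ht he using fun i : Fin 4 => hint (Pi.single i 2) (by rw [hsum]; decide)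
  have ht' : ∀ i k, (t i k : ℝ) = 2 * S k i := fun i k => by
    rw [← ht i k]
    simp [Pi.single_apply, mul_comm]
  have hdot : ∀ i j, t i 0 * t j 0 + t i 1 * t j 1 + t i 2 * t j 2 + t i 3 * t j 3 =
      if i = j then 4 * (M : ℤ) else 0 := fun i j => by
    have h := H i j
    rw [Fin.sum_univ_four] at h
    have : ((t i 0 * t j 0 + t i 1 * t j 1 + t i 2 * t j 2 + t i 3 * t j 3 : ℤ) : ℝ) =
        ((if i = j then 4 * (M : ℤ) else 0 : ℤ) : ℝ) := by
      push_cast [ht']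
      split_ifs at h ⊢ <;> linear_combination 4 * h
    exact_mod_cast this
  refine ⟨fun i => (t i 0, t i 1, t i 2, t i 3), fun i => ⟨ht' i 0, ht' i 1, ht' i 2, ht' i 3⟩,
    fun i => by simpa [dot4] using hdot i i, fun i => by simpa [dot4] using he i,
    fun i j hij => ?_⟩
  obtain ⟨s, hs, l, hl⟩ := hint (Pi.single i 1 + Pi.single j 1) (by
    have h1 := hsum i 1
    have h2 := hsum j 1
    exact ⟨1, by simp only [Pi.add_apply]; linarith⟩)
  have hst : ∀ k, t i k + t j k = 2 * s k := fun k => by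
    have h := hs k
    simp [Pi.single_apply, mul_add, Finset.sum_add_distrib] at h
    have : ((t i k + t j k : ℤ) : ℝ) = ((2 * s k : ℤ) : ℝ) := by
      push_cast [ht', ← h]
      ring
    exact_mod_cast this
  have h0 := hst 0
  have h1 := hst 1
  have h2 := hst 2
  have h3 := hst 3
  refine ⟨by simpa [dot4, hij] using hdot i j, ?_, ?_, ?_, ?_, ?_⟩ <;>
    simp only [dot4, mul_one] <;> omega

theorem stmt17 (M : ℕ) (hM : M = 3 ∨ M = 9 ∨ M = 11) :
    ¬ ∃ Λ' : AddSubgroup (EuclideanSpace ℝ (Fin 4)),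
        IsSimilarSublattice D4 Λ' (M ^ 2) ∧ IsClean D4 Λ' := by
  rintro ⟨Λ', hsim, hclean⟩
  obtain ⟨S, hS, rfl⟩ := hsim.exists_matrix
  obtain ⟨b, hbS, hn, he, hc⟩ := exists_integral_frame hS hsim.1
  obtain ⟨x, hx, hz⟩ := exists_onVoronoiBoundary (M := M) (by omega) b hn he hc
  obtain ⟨v, hv0, hv, heq⟩ := hz.exists_dot4_eq
  have hxe : Even (x.1 + x.2.1 + x.2.2.1 + x.2.2.2) :=
    (by decide : ∀ y ∈ witnesses, Even (y.1 + y.2.1 + y.2.2.1 + y.2.2.2)) x hx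
  have hpair : ∀ w : ℤ × ℤ × ℤ × ℤ,
      2 * ∑ i, (∑ k, S k i * intPoint x k) * intPoint w i =
        ((dot4 (dot4 (b 0) x, dot4 (b 1) x, dot4 (b 2) x, dot4 (b 3) x) w : ℤ) : ℝ) := fun w => by
    simp [dot4, intPoint, Fin.sum_univ_four, hbS]
    ring
  have hsq : ∀ w : ℤ × ℤ × ℤ × ℤ,
      ∑ i, intPoint w i * intPoint w i = ((dot4 w w : ℤ) : ℝ) := fun w => by
    simp [dot4, intPoint, Fin.sum_univ_four]
  refine not_isClean_of_tie (by rcases hM with rfl | rfl | rfl <;> norm_num) hS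
    (mem_D4_iff_intPoint.2 ⟨x, hxe, rfl⟩) (mem_D4_iff_intPoint.2 ⟨v, hv, rfl⟩)
    (intPoint_ne_zero hv0) ?_ ?_ hclean
  · intro w hw
    obtain ⟨w, hwe, rfl⟩ := mem_D4_iff_intPoint.1 hw
    rw [hpair, hsq]
    exact_mod_cast hz.dot4_le w hwe
  · rw [hpair, hsq]
    exact_mod_cast heq
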